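/- Every K_4-minor-free graph has chromatic number at most 3. -/

import Mathlib

/-- `H` is a minor of `G`: there is a family of nonempty, pairwise disjoint,
connected branch sets in `G`, one for each vertex of `H`, such that adjacent
vertices of `H` have adjacent branch sets. -/
def SimpleGraph.IsMinorOf {W V : Type*} (H : SimpleGraph W) (G : SimpleGraph V) : Prop :=
  ∃ B : W → Set V,
    (∀ w, (B w).Nonempty) ∧
    (∀ w, (G.induce (B w)).Connected) ∧
    (Pairwise fun w₁ w₂ => Disjoint (B w₁) (B w₂)) ∧
    ∀ ⦃w₁ w₂⦄, H.Adj w₁ w₂ → ∃ v₁ ∈ B w₁, ∃ v₂ ∈ B w₂, G.Adj v₁ v₂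

/-- `G` has no `K_t`-minor (`K_t` is the complete graph on `t` vertices). -/
def SimpleGraph.KMinorFree {V : Type*} (G : SimpleGraph V) (t : ℕ) : Prop :=
  ¬ (completeGraph (Fin t)).IsMinorOf G

namespace SimpleGraph

section Minors

variable {U V W : Type*}

lemma connected_induce_singleton (G : SimpleGraph V) (v : V) :
    (G.induce ({v} : Set V)).Connected := by
  have : Nonempty ({v} : Set V) := ⟨⟨v, rfl⟩⟩
  refine ⟨fun x y => ?_⟩
  rw [Subsingleton.elim x y]

lemma connected_induce_insert {G : SimpleGraph V} {s : Set V} {x y : V}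
    (hs : (G.induce s).Connected) (hx : x ∈ s) (h : G.Adj x y) :
    (G.induce (insert y s)).Connected := by
  have := induce_union_connected hs.preconnected (induce_pair_connected_of_adj h).preconnected
    ⟨x, hx, by simp⟩
  convert this using 2
  all_goals
    ext z
    simp only [Set.mem_insert_iff, Set.mem_union, Set.mem_singleton_iff]
    constructor
    · tauto
    · rintro (h | rfl | h)
      exacts [.inr h, .inr hx, .inl h]

lemma connected_induce_biUnion {K : SimpleGraph U} {G : SimpleGraph V} {C : U → Set V}
    (hC : ∀ u, (G.induce (C u)).Connected)
    (hadj : ∀ ⦃u u'⦄, K.Adj u u' → ∃ v ∈ C u, ∃ v' ∈ C u', G.Adj v v')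
    {s : Set U} (hs : (K.induce s).Connected) :
    (G.induce (⋃ u ∈ s, C u)).Connected := by
  have hsub : ∀ u ∈ s, C u ⊆ ⋃ u ∈ s, C u := fun u hu => Set.subset_biUnion_of_mem hu
  have hpatch : ∀ u (hu : u ∈ s) (p q : V) (hp : p ∈ C u) (hq : q ∈ C u),
      (G.induce (⋃ u ∈ s, C u)).Reachable ⟨p, hsub u hu hp⟩ ⟨q, hsub u hu hq⟩ := by
    intro u hu p q hp hq
    exact ((hC u).preconnected ⟨p, hp⟩ ⟨q, hq⟩).map (induceHomOfLE G (hsub u hu)).toHom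
  have hwalk : ∀ (x y : s), (K.induce s).Walk x y → ∀ p q (hp : p ∈ C x) (hq : q ∈ C y),
      (G.induce (⋃ u ∈ s, C u)).Reachable ⟨p, hsub x x.2 hp⟩ ⟨q, hsub y y.2 hq⟩ := by
    intro x y w
    induction w with
    | @nil x => exact fun p q hp hq => hpatch x x.2 p q hp hq
    | @cons x z y h w ih =>
      intro p q hp hq
      obtain ⟨v, hv, v', hv', hvv⟩ := hadj (show K.Adj x z from h)
      have hstep : (G.induce (⋃ u ∈ s, C u)).Adj ⟨v, hsub x x.2 hv⟩ ⟨v', hsub z z.2 hv'⟩ := hvv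
      exact (hpatch x x.2 p v hp hv).trans (hstep.reachable.trans (ih v' q hv' hq))
  obtain ⟨⟨u, hu⟩⟩ := hs.nonempty
  obtain ⟨⟨v, hv⟩⟩ := (hC u).nonempty
  rw [connected_iff]
  refine ⟨?_, ⟨⟨v, hsub u hu hv⟩⟩⟩
  rintro ⟨p, hp⟩ ⟨q, hq⟩
  simp only [Set.mem_iUnion] at hp hq
  obtain ⟨x, hx, hp⟩ := hp
  obtain ⟨y, hy, hq⟩ := hq
  obtain ⟨w⟩ := hs.preconnected ⟨x, hx⟩ ⟨y, hy⟩
  exact hwalk _ _ w p q hp hq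

lemma IsMinorOf.trans {H : SimpleGraph W} {K : SimpleGraph U} {G : SimpleGraph V}
    (hHK : H.IsMinorOf K) (hKG : K.IsMinorOf G) : H.IsMinorOf G := by
  obtain ⟨B, hB, hBc, hBd, hBa⟩ := hHK
  obtain ⟨C, hC, hCc, hCd, hCa⟩ := hKG
  refine ⟨fun w => ⋃ u ∈ B w, C u, fun w => ?_, fun w => connected_induce_biUnion hCc hCa (hBc w),
    fun w₁ w₂ h => ?_, fun w₁ w₂ h => ?_⟩
  · obtain ⟨u, hu⟩ := hB w
    obtain ⟨v, hv⟩ := hC u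
    exact ⟨v, Set.mem_biUnion hu hv⟩
  · simp only [Set.disjoint_iUnion_left, Set.disjoint_iUnion_right]
    intro x hx y hy
    refine hCd ?_
    rintro rfl
    exact Set.disjoint_left.1 (hBd h) ‹_› ‹_›
  · obtain ⟨x, hx, y, hy, hxy⟩ := hBa h
    obtain ⟨p, hp, q, hq, hpq⟩ := hCa hxy
    exact ⟨p, Set.mem_biUnion hx hp, q, Set.mem_biUnion hy hq, hpq⟩

lemma induce_isMinorOf (G : SimpleGraph V) (s : Set V) : (G.induce s).IsMinorOf G :=
  ⟨fun x => {x.1}, fun _ => Set.singleton_nonempty _, fun x => connected_induce_singleton G x,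
    fun x y h => by simpa [Subtype.ext_iff] using h,
    fun x y h => ⟨x, rfl, y, rfl, h⟩⟩

lemma KMinorFree.of_isMinorOf {H : SimpleGraph U} {G : SimpleGraph V} {t : ℕ}
    (hG : G.KMinorFree t) (h : H.IsMinorOf G) : H.KMinorFree t :=
  fun hH => hG (hH.trans h)

/-- A connected set together with a `K_t`-minor in its neighbourhood yields a `K_{t+1}`-minor. -/
lemma completeGraph_succ_isMinorOf {G : SimpleGraph V} {t : ℕ} {X S : Set V}
    (hX : (G.induce X).Connected) (hd : Disjoint X S) (hadj : ∀ y ∈ S, ∃ x ∈ X, G.Adj x y)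
    (hS : (completeGraph (Fin t)).IsMinorOf (G.induce S)) :
    (completeGraph (Fin (t + 1))).IsMinorOf G := by
  obtain ⟨B, hB, hBc, hBd, hBa⟩ := hS
  have hsub : ∀ i, ((↑) '' B i : Set V) ⊆ S := by
    rintro i _ ⟨x, -, rfl⟩
    exact x.2
  have hcross : ∀ i, ∃ v ∈ X, ∃ w ∈ ((↑) '' B i : Set V), G.Adj v w := by
    intro i
    obtain ⟨b, hb⟩ := hB i
    obtain ⟨x, hx, h⟩ := hadj b b.2
    exact ⟨x, hx, b, ⟨b, hb, rfl⟩, h⟩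
  refine ⟨Fin.cons X fun i => (↑) '' B i, ?_, ?_, ?_, ?_⟩
  · refine Fin.cases ?_ fun i => ?_
    · obtain ⟨x⟩ := hX.nonempty
      exact ⟨x.1, x.2⟩
    · simpa using hB i
  · refine Fin.cases hX fun i => ?_
    have := connected_induce_biUnion (K := G.induce S) (G := G) (C := fun x => {x.1})
      (fun x => connected_induce_singleton G x) (fun x y h => ⟨x, rfl, y, rfl, h⟩) (hBc i)
    rw [← Set.image_eq_iUnion] at this
    exact this
  · intro i j
    refine Fin.cases ?_ (fun i => ?_) i <;> refine Fin.cases ?_ (fun j => ?_) j <;> intro h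
    · exact absurd rfl h
    · simpa using hd.mono_right (hsub j)
    · simpa using (hd.mono_right (hsub i)).symm
    · simp only [Fin.cons_succ]
      rw [Set.disjoint_image_iff Subtype.val_injective]
      exact hBd fun hij => h (hij ▸ rfl)
  · intro i j
    refine Fin.cases ?_ (fun i => ?_) i <;> refine Fin.cases ?_ (fun j => ?_) j <;> intro h
    · exact absurd h (completeGraph _).irrefl
    · simpa using hcross j
    · obtain ⟨v, hv, w, hw, hvw⟩ := hcross i
      exact ⟨w, by simpa using hw, v, by simpa using hv, hvw.symm⟩
    · obtain ⟨x, hx, y, hy, hxy⟩ := hBa (show (completeGraph (Fin t)).Adj i j from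
        fun hij => h (hij ▸ rfl))
      exact ⟨x, ⟨x, hx, rfl⟩, y, ⟨y, hy, rfl⟩, hxy⟩

lemma completeGraph_three_isMinorOf {G : SimpleGraph V} {u z : V} {S : Set V}
    (hS : (G.induce S).Connected) (huS : u ∉ S) (hzS : z ∉ S) (huz : G.Adj u z)
    (hu : ∃ v ∈ S, G.Adj u v) (hz : ∃ v ∈ S, G.Adj z v) :
    (completeGraph (Fin 3)).IsMinorOf G := by
  obtain ⟨a, ha, hua⟩ := hu
  obtain ⟨b, hb, hzb⟩ := hz
  have hne := huz.ne
  refine ⟨![{u}, {z}, S], ?_, ?_, ?_, ?_⟩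
  · intro i
    fin_cases i
    exacts [Set.singleton_nonempty _, Set.singleton_nonempty _, ⟨a, ha⟩]
  · intro i
    fin_cases i
    exacts [connected_induce_singleton _ _, connected_induce_singleton _ _, hS]
  · intro i j h
    fin_cases i <;> fin_cases j <;> simp_all [hne.symm]
  · intro i j h
    fin_cases i <;> fin_cases j
    exacts [absurd rfl h, ⟨u, rfl, z, rfl, huz⟩, ⟨u, rfl, a, ha, hua⟩,
      ⟨z, rfl, u, rfl, huz.symm⟩, absurd rfl h, ⟨z, rfl, b, hb, hzb⟩,
      ⟨a, ha, u, rfl, hua.symm⟩, ⟨b, hb, z, rfl, hzb.symm⟩, absurd rfl h]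

/-- A nonempty finite graph in which every vertex has two neighbours has a `K_3`-minor. -/
lemma completeGraph_three_isMinorOf_of_two_neighbors [Finite V] [Nonempty V] {G : SimpleGraph V}
    (h : ∀ v, ∃ a b, a ≠ b ∧ G.Adj v a ∧ G.Adj v b) :
    (completeGraph (Fin 3)).IsMinorOf G := by
  classical
  by_contra hG
  have key : ∀ n : ℕ, ∃ (u v : V) (p : G.Walk u v), p.IsPath ∧ p.length = n := by
    intro n
    induction n with
    | zero => exact ⟨Classical.arbitrary V, _, .nil, .nil, rfl⟩
    | succ n ih =>
      obtain ⟨u, v, p, hp, hn⟩ := ih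
      by_cases hx : ∃ x, G.Adj u x ∧ x ∉ p.support
      · obtain ⟨x, hux, hxp⟩ := hx
        exact ⟨x, v, .cons hux.symm p, hp.cons hxp, by simp [hn]⟩
      · push Not at hx
        exfalso
        cases p with
        | nil =>
          obtain ⟨a, -, -, ha, -⟩ := h u
          have := hx a ha
          simp only [Walk.support_nil, List.mem_singleton] at this
          exact ha.ne this.symm
        | @cons _ w _ huw q =>
          rw [Walk.cons_isPath_iff] at hp
          obtain ⟨z, hzw, huz⟩ : ∃ z, z ≠ w ∧ G.Adj u z := by
            obtain ⟨a, b, hab, ha, hb⟩ := h u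
            by_cases haw : a = w
            · exact ⟨b, fun hbw => hab (haw.trans hbw.symm), hb⟩
            · exact ⟨a, haw, ha⟩
          have hzq : z ∈ q.support := by
            have := hx z huz
            rw [Walk.support_cons, List.mem_cons] at this
            exact this.resolve_left huz.ne'
          have hr : (q.takeUntil z hzq).reverse.IsPath := (hp.1.takeUntil hzq).reverse
          have hru : u ∉ (q.takeUntil z hzq).reverse.support := by
            rw [Walk.support_reverse, List.mem_reverse]
            exact fun hu => hp.2 (q.support_takeUntil_subset_support hzq hu)
          revert hr hru
          generalize (q.takeUntil z hzq).reverse = r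
          intro hr hru
          cases r with
          | nil => exact hzw rfl
          | @cons _ z' _ hz s =>
            rw [Walk.cons_isPath_iff] at hr
            rw [Walk.support_cons, List.mem_cons, not_or] at hru
            exact hG (completeGraph_three_isMinorOf s.connected_induce_support hru.2 hr.2 huz
              ⟨w, s.end_mem_support, huw⟩ ⟨z', s.start_mem_support, hz⟩)
  have := Fintype.ofFinite V
  obtain ⟨u, v, p, hp, hn⟩ := key (Fintype.card V)
  exact hp.length_lt.ne hn

end Minors

section Counting

open Finset

variable {V : Type*} [Fintype V] [DecidableEq V] (G : SimpleGraph V) [DecidableRel G.Adj]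

/-- The adjacent ordered pairs of vertices outside `X`. -/
def dartsOutside (X : Finset V) : Finset (V × V) :=
  {p | p.1 ∉ X ∧ p.2 ∉ X ∧ G.Adj p.1 p.2}

/-- The vertices outside `X` with a neighbour in `X`. -/
def outerBoundary (X : Finset V) : Finset V :=
  {u | u ∉ X ∧ ∃ x ∈ X, G.Adj x u}

variable {G}

lemma card_dartsOutside_insert {X : Finset V} {y : V} (hy : y ∉ X) :
    #(G.dartsOutside X) = #(G.dartsOutside (insert y X)) + 2 * #(G.neighborFinset y \ X) := by
  set D := G.neighborFinset y \ X with hD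
  have h : G.dartsOutside X = G.dartsOutside (insert y X) ∪ ({y} ×ˢ D ∪ D ×ˢ {y}) := by
    ext ⟨a, b⟩
    simp only [dartsOutside, hD, mem_filter, mem_univ, true_and, mem_union, mem_product,
      mem_singleton, mem_insert, mem_sdiff, mem_neighborFinset]
    by_cases ha : a = y <;> by_cases hb : b = y <;> simp [ha, hb, hy, G.adj_comm] <;> tauto
  have h1 : Disjoint (G.dartsOutside (insert y X)) ({y} ×ˢ D ∪ D ×ˢ {y}) := by
    rw [Finset.disjoint_left]
    rintro ⟨a, b⟩
    simp only [dartsOutside, mem_filter, mem_univ, true_and, mem_union, mem_product,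
      mem_singleton, mem_insert]
    tauto
  have h2 : Disjoint ({y} ×ˢ D) (D ×ˢ {y}) := by
    rw [Finset.disjoint_left]
    rintro ⟨a, b⟩
    simp only [mem_product, mem_singleton, hD, mem_sdiff, mem_neighborFinset]
    rintro ⟨rfl, -⟩ ⟨⟨h, -⟩, -⟩
    exact G.irrefl h
  rw [h, card_union_of_disjoint h1, card_union_of_disjoint h2, card_product, card_product,
    card_singleton]
  ring

lemma card_outerBoundary_insert {X : Finset V} {y : V} (hy : y ∈ G.outerBoundary X) :
    #(G.outerBoundary (insert y X)) + 1 + #(G.neighborFinset y ∩ G.outerBoundary X) =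
      #(G.outerBoundary X) + #(G.neighborFinset y \ X) := by
  have h : insert y (G.outerBoundary (insert y X)) =
      G.outerBoundary X ∪ (G.neighborFinset y \ X) := by
    ext a
    have : y ∉ X ∧ ∃ x ∈ X, G.Adj x y := by simpa [outerBoundary] using hy
    by_cases ha : a = y
    · simp [ha, outerBoundary, this]
    · simp only [outerBoundary, mem_insert, ha, exists_eq_or_imp, mem_filter, mem_univ, true_and,
        mem_union, mem_sdiff, mem_neighborFinset, not_or, not_false_eq_true, false_or]
      generalize (∃ x ∈ X, G.Adj x a) = p
      tauto
  have h' : G.neighborFinset y ∩ G.outerBoundary X =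
      G.outerBoundary X ∩ (G.neighborFinset y \ X) := by
    ext a
    simp [outerBoundary]
    tauto
  have hn : y ∉ G.outerBoundary (insert y X) := by simp [outerBoundary]
  rw [h', ← card_insert_of_notMem hn, h, card_union_add_card_inter]

/-- A version of Mader's theorem for `K_4`: a `K_4`-minor-free graph of minimum degree at least
four has a nonempty proper vertex subset that is not joined to its complement. -/
lemma exists_finset_no_adj_compl [Nonempty V] (hG : G.KMinorFree 4) (hdeg : ∀ v, 4 ≤ G.degree v) :
    ∃ X : Finset V, X.Nonempty ∧ Xᶜ.Nonempty ∧ ∀ x ∈ X, ∀ y ∉ X, ¬ G.Adj x y := by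
  let P : Finset V → Prop := fun X => (G.induce (X : Set V)).Connected ∧
    4 * #Xᶜ < #(G.dartsOutside X) + 2 * #(G.outerBoundary X)
  have hP : ∃ X, P X := by
    let v := Classical.arbitrary V
    refine ⟨{v}, by rw [coe_singleton]; exact connected_induce_singleton G v, ?_⟩
    have h0 : #(G.dartsOutside ∅) = ∑ u, G.degree u := by
      have : G.dartsOutside ∅ = (univ.sigma fun u => G.neighborFinset u).map
          (Equiv.sigmaEquivProd V V).toEmbedding := by
        ext ⟨a, b⟩
        simp [dartsOutside]
      rw [this, card_map, card_sigma]
      simp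
    have h1 := card_dartsOutside_insert (G := G) (notMem_empty v)
    have h2 : G.outerBoundary {v} = G.neighborFinset v := by
      ext u
      simp only [outerBoundary, mem_filter, mem_univ, true_and, mem_singleton, exists_eq_left,
        mem_neighborFinset, and_iff_right_iff_imp]
      exact fun h => h.ne'
    have h3 : 4 * Fintype.card V ≤ ∑ u, G.degree u := by
      have := Finset.card_nsmul_le_sum univ (fun u => G.degree u) 4 fun u _ => hdeg u
      simpa [mul_comm] using this
    have h4 : 0 < Fintype.card V := Fintype.card_pos
    simp only [insert_empty_eq, sdiff_empty] at h1
    rw [h2, card_compl, card_singleton]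
    omega
  obtain ⟨X, ⟨hXc, hXe⟩, hmax⟩ := (Set.toFinite {X | P X}).exists_maximal hP
  have hXne : X.Nonempty := by
    obtain ⟨x⟩ := hXc.nonempty
    exact ⟨x.1, x.2⟩
  have hbd : ∀ y ∈ G.outerBoundary X, ∃ a b, a ≠ b ∧ a ∈ G.outerBoundary X ∧
      b ∈ G.outerBoundary X ∧ G.Adj y a ∧ G.Adj y b := by
    intro y hy
    by_cases hk : 1 < #(G.neighborFinset y ∩ G.outerBoundary X)
    · obtain ⟨a, ha, b, hb, hab⟩ := one_lt_card.1 hk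
      simp only [mem_inter, mem_neighborFinset] at ha hb
      exact ⟨a, b, hab, ha.2, hb.2, ha.1, hb.1⟩
    · exfalso
      obtain ⟨hyX, x, hx, hxy⟩ : y ∉ X ∧ ∃ x ∈ X, G.Adj x y := by
        simpa [outerBoundary] using hy
      have h1 := card_dartsOutside_insert (G := G) hyX
      have h2 := card_outerBoundary_insert hy
      have h3 : #(insert y X)ᶜ + 1 = #Xᶜ := by
        have := card_add_card_compl X
        have := card_add_card_compl (insert y X)
        rw [card_insert_of_notMem hyX] at this
        omega
      refine hyX (hmax (y := insert y X) ⟨?_, ?_⟩ (subset_insert y X) (mem_insert_self y X))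
      · rw [coe_insert]
        exact connected_induce_insert hXc hx hxy
      · omega
  refine ⟨X, hXne, ?_, ?_⟩
  · rw [nonempty_iff_ne_empty]
    intro h
    have hX : X = univ := by simpa using h
    simp [hX, dartsOutside, outerBoundary] at hXe
  · intro x hx y hy hxy
    have hyN : y ∈ G.outerBoundary X := by
      simp only [outerBoundary, mem_filter, mem_univ, true_and]
      exact ⟨hy, x, hx, hxy⟩
    refine hG (completeGraph_succ_isMinorOf (S := G.outerBoundary X) hXc ?_ ?_ ?_)
    · rw [Finset.disjoint_coe, Finset.disjoint_left]
      simp +contextual [outerBoundary]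
    · intro y hy
      have : y ∉ X ∧ ∃ x ∈ X, G.Adj x y := by simpa [outerBoundary] using hy
      exact this.2
    · have : Nonempty (G.outerBoundary X : Set V) := ⟨⟨y, hyN⟩⟩
      refine completeGraph_three_isMinorOf_of_two_neighbors ?_
      rintro ⟨z, hz⟩
      obtain ⟨a, b, hab, ha, hb, hza, hzb⟩ := hbd z hz
      exact ⟨⟨a, ha⟩, ⟨b, hb⟩, by simpa using hab, hza, hzb⟩

end Counting

section Coloring

open Finset

variable {V : Type*}

/-- A 3-colouring of `G - v` that uses at most two colours on the neighbours of `v` extends. -/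
lemma colorable_three_of_update [DecidableEq V] {G : SimpleGraph V} {v : V} (c : V → Fin 3)
    (hc : ∀ x y, x ≠ v → y ≠ v → G.Adj x y → c x ≠ c y) (T : Finset (Fin 3)) (hT : #T ≤ 2)
    (hvT : ∀ x, G.Adj v x → c x ∈ T) : G.Colorable 3 := by
  obtain ⟨k, hk⟩ : ∃ k, k ∉ T := by
    by_contra! h
    have : T = univ := by ext; simp [h]
    simp [this] at hT
  refine ⟨Coloring.mk (Function.update c v k) ?_⟩
  intro x y hxy
  by_cases hx : x = v
  · subst hx
    rw [Function.update_self, Function.update_of_ne hxy.ne']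
    exact fun h => hk (h ▸ hvT y hxy)
  · by_cases hy : y = v
    · subst hy
      rw [Function.update_self, Function.update_of_ne hx]
      exact fun h => hk (h ▸ hvT x hxy.symm)
    · rw [Function.update_of_ne hx, Function.update_of_ne hy]
      exact hc x y hx hy hxy

/-- The graph obtained from `G - v` by identifying `b` with `a`. -/
def identify (G : SimpleGraph V) (v a b : V) : SimpleGraph {x // x ≠ v ∧ x ≠ b} where
  Adj x y := x ≠ y ∧ (G.Adj x y ∨ (x.1 = a ∧ G.Adj b y) ∨ (y.1 = a ∧ G.Adj b x))
  symm := ⟨fun x y h => ⟨h.1.symm, by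
    rcases h.2 with h | h | h
    exacts [.inl h.symm, .inr (.inr h), .inr (.inl h)]⟩⟩
  loopless := ⟨fun _ h => h.1 rfl⟩

lemma identify_isMinorOf {G : SimpleGraph V} {v a b : V} (hva : G.Adj v a) (hvb : G.Adj v b) :
    (G.identify v a b).IsMinorOf G := by
  classical
  have hab : (G.induce {b, v, a}).Connected :=
    connected_induce_insert (induce_pair_connected_of_adj hva) (by simp) hvb
  refine ⟨fun x => if x.1 = a then {b, v, a} else {x.1}, fun x => ?_, fun x => ?_,
    fun x y h => ?_, fun x y h => ?_⟩
  · dsimp only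
    split_ifs <;> simp
  · beta_reduce
    by_cases hx : x.1 = a
    · rw [if_pos hx]
      exact hab
    · rw [if_neg hx]
      exact connected_induce_singleton _ _
  · obtain ⟨x, hxv, hxb⟩ := x
    obtain ⟨y, hyv, hyb⟩ := y
    have hxy : x ≠ y := by simpa using h
    dsimp only [Function.onFun]
    split_ifs with h1 h2 h2
    · exact absurd (h1.trans h2.symm) hxy
    · simp [h2, hyv, hyb]
    · simp [h1, hxv, hxb]
    · simpa using hxy
  · have hmem : ∀ z : {x // x ≠ v ∧ x ≠ b},
        z.1 ∈ (if z.1 = a then {b, v, a} else {z.1} : Set V) := by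
      intro z
      split_ifs with hz <;> simp [hz]
    rcases h.2 with h | ⟨h1, h⟩ | ⟨h1, h⟩
    · exact ⟨x, hmem x, y, hmem y, h⟩
    · exact ⟨b, by simp [h1], y, hmem y, h⟩
    · exact ⟨x, hmem x, b, by simp [h1], h.symm⟩

lemma colorable_three_of_identify [Fintype V] [DecidableEq V] {G : SimpleGraph V}
    [DecidableRel G.Adj] {v a b : V} (hva : G.Adj v a) (hvb : G.Adj v b) (hab : a ≠ b)
    (hnab : ¬ G.Adj a b) (hdeg : G.degree v ≤ 3) (h : (G.identify v a b).Colorable 3) :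
    G.Colorable 3 := by
  obtain ⟨c⟩ := h
  let f : V → {x // x ≠ v ∧ x ≠ b} := fun x =>
    if hx : x ≠ v ∧ x ≠ b then ⟨x, hx⟩ else ⟨a, hva.ne', hab⟩
  have hfb : f b = ⟨a, hva.ne', hab⟩ := by simp [f]
  have hf : ∀ x (hx : x ≠ v ∧ x ≠ b), f x = ⟨x, hx⟩ := fun x hx => dif_pos hx
  refine colorable_three_of_update (v := v) (fun x => c (f x)) ?_
    (((G.neighborFinset v).erase b).image fun x => c (f x)) ?_ ?_
  · intro x y hx hy hxy
    apply c.valid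
    by_cases hxb : x = b
    · subst hxb
      rw [hfb, hf y ⟨hy, hxy.ne'⟩]
      refine ⟨?_, .inr (.inl ⟨rfl, hxy⟩)⟩
      rintro h
      rw [Subtype.mk.injEq] at h
      exact hnab (h ▸ hxy.symm)
    · by_cases hyb : y = b
      · subst hyb
        rw [hfb, hf x ⟨hx, hxb⟩]
        refine ⟨?_, .inr (.inr ⟨rfl, hxy.symm⟩)⟩
        rintro h
        rw [Subtype.mk.injEq] at h
        exact hnab (h ▸ hxy)
      · rw [hf x ⟨hx, hxb⟩, hf y ⟨hy, hyb⟩]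
        exact ⟨by simpa using hxy.ne, .inl hxy⟩
  · refine card_image_le.trans ?_
    rw [card_erase_of_mem (by simpa using hvb), card_neighborFinset_eq_degree]
    omega
  · intro x hx
    by_cases hxb : x = b
    · subst hxb
      refine mem_image.2 ⟨a, by simp [hab, hva], ?_⟩
      rw [hfb, hf a ⟨hva.ne', hab⟩]
    · exact mem_image.2 ⟨x, by simp [hxb, hx], rfl⟩

lemma colorable_three_of_degree_le_two [Fintype V] [DecidableEq V] {G : SimpleGraph V}
    [DecidableRel G.Adj] {v : V} (hdeg : G.degree v ≤ 2)
    (h : (G.induce {x | x ≠ v}).Colorable 3) : G.Colorable 3 := by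
  obtain ⟨c⟩ := h
  let f : V → Fin 3 := fun x => if hx : x ≠ v then c ⟨x, hx⟩ else 0
  refine colorable_three_of_update (v := v) f ?_ ((G.neighborFinset v).image f) ?_ ?_
  · intro x y hx hy hxy
    simp only [f, dif_pos hx, dif_pos hy]
    exact c.valid hxy
  · exact card_image_le.trans (by simpa using hdeg)
  · exact fun x hx => mem_image_of_mem _ (by simpa using hx)

lemma colorable_of_no_adj_compl {G : SimpleGraph V} {n : ℕ} {s : Set V}
    (hs : ∀ x ∈ s, ∀ y ∉ s, ¬ G.Adj x y) (h : (G.induce s).Colorable n)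
    (h' : (G.induce sᶜ).Colorable n) : G.Colorable n := by
  classical
  obtain ⟨c⟩ := h
  obtain ⟨c'⟩ := h'
  refine ⟨Coloring.mk (fun x => if hx : x ∈ s then c ⟨x, hx⟩ else c' ⟨x, hx⟩) ?_⟩
  intro x y hxy
  by_cases hx : x ∈ s <;> by_cases hy : y ∈ s
  · simp only [dif_pos hx, dif_pos hy]
    exact c.valid hxy
  · exact absurd hxy (hs x hx y hy)
  · exact absurd hxy.symm (hs y hy x hx)
  · simp only [dif_neg hx, dif_neg hy]
    exact c'.valid hxy

/-- In a `K_4`-minor-free graph, a vertex of degree three has two nonadjacent neighbours. -/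
lemma exists_nonadj_neighbors [Fintype V] {G : SimpleGraph V}
    [DecidableRel G.Adj] (hG : G.KMinorFree 4) {v : V} (hdeg : G.degree v = 3) :
    ∃ a b, G.Adj v a ∧ G.Adj v b ∧ a ≠ b ∧ ¬ G.Adj a b := by
  by_contra! h
  refine hG (completeGraph_succ_isMinorOf (X := {v}) (S := G.neighborSet v)
    (connected_induce_singleton G v) (by simp) (fun y hy => ⟨v, rfl, hy⟩) ?_)
  have : Nonempty (G.neighborSet v) := by
    obtain ⟨x, hx⟩ := card_pos.1 (show 0 < #(G.neighborFinset v) by simp [hdeg])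
    exact ⟨⟨x, by simpa using hx⟩⟩
  refine completeGraph_three_isMinorOf_of_two_neighbors ?_
  rintro ⟨x, hx⟩
  classical
  have hcard : 1 < #((G.neighborFinset v).erase x) := by
    rw [card_erase_of_mem (by simpa using hx), card_neighborFinset_eq_degree, hdeg]
    decide
  obtain ⟨a, ha, b, hb, hab⟩ := one_lt_card.1 hcard
  simp only [mem_erase, mem_neighborFinset] at ha hb
  exact ⟨⟨a, ha.2⟩, ⟨b, hb.2⟩, fun e => hab (congrArg Subtype.val e), h x a hx ha.2 ha.1.symm,
    h x b hx hb.2 hb.1.symm⟩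

theorem KMinorFree.colorable_three [Finite V] {G : SimpleGraph V} (hG : G.KMinorFree 4) :
    G.Colorable 3 := by
  classical
  induction hn : Nat.card V using Nat.strong_induction_on generalizing V with
  | _ n ih =>
  subst hn
  have := Fintype.ofFinite V
  have hsub : ∀ (p : V → Prop) (x : V), ¬ p x → Nat.card {x // p x} < Nat.card V := by
    intro p x hx
    rw [Nat.card_eq_fintype_card, Nat.card_eq_fintype_card]
    exact Fintype.card_subtype_lt hx
  have hind : ∀ (s : Set V) (x : V), x ∉ s → (G.induce s).Colorable 3 := fun s x hx =>
    ih _ (hsub (· ∈ s) x hx) (hG.of_isMinorOf (induce_isMinorOf G s)) rfl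
  cases isEmpty_or_nonempty V
  · exact Colorable.of_isEmpty 3
  by_cases hdeg : ∀ v, 4 ≤ G.degree v
  · obtain ⟨X, ⟨x, hx⟩, ⟨y, hy⟩, hX⟩ := exists_finset_no_adj_compl hG hdeg
    exact colorable_of_no_adj_compl (s := X) hX (hind X y (by simpa using hy))
      (hind _ x (by simpa using hx))
  · push Not at hdeg
    obtain ⟨v, hv⟩ := hdeg
    by_cases h3 : G.degree v = 3
    · obtain ⟨a, b, hva, hvb, hab, hnab⟩ := exists_nonadj_neighbors hG h3
      exact colorable_three_of_identify hva hvb hab hnab h3.le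
        (ih _ (hsub _ v (by simp)) (hG.of_isMinorOf (identify_isMinorOf hva hvb)) rfl)
    · exact colorable_three_of_degree_le_two (v := v) (by omega) (hind _ v (by simp))

end Coloring

end SimpleGraph

/-- Every `K_4`-minor-free graph has chromatic number at most 3. -/
theorem chromatic_K4_minor_free
    (V : Type) [Fintype V] (G : SimpleGraph V) (hG : G.KMinorFree 4) :
    G.chromaticNumber ≤ 3 :=
  SimpleGraph.chromaticNumber_le_iff_colorable.2 hG.colorable_three
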